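/- The upper bound δ_U is submodular: for all M ⊆ N ⊆ V and all v ∉ N, δ_U(M ∪ {v}) − δ_U(M) ≥ δ_U(N ∪ {v}) − δ_U(N). -/

import Mathlib

open scoped Classical
open Finset

noncomputable section

/-- The set of vertices reachable from the seed set `S` along edges of `g`. -/
def reach {V : Type*} [Fintype V] (g : Finset (V × V)) (S : Finset V) : Finset V :=
  Finset.univ.filter fun v => ∃ u ∈ S, Relation.ReflTransGen (fun a b => (a, b) ∈ g) u v

/-- The vertex weight `w(v) = (1/2)(Σ_{u:(u,v)∈E} A(u,v) + Σ_{u:(v,u)∈E} A(v,u))`. -/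
def w {V : Type*} [Fintype V] (E : Finset (V × V)) (A : V × V → ℝ) (v : V) : ℝ :=
  (1 / 2) * ((∑ u ∈ Finset.univ.filter (fun u => (u, v) ∈ E), A (u, v))
    + ∑ u ∈ Finset.univ.filter (fun u => (v, u) ∈ E), A (v, u))

/-- The upper bound `δ_U(S)`. -/
def deltaU {V : Type*} [Fintype V] (E : Finset (V × V)) (A : V × V → ℝ)
    (μ : Finset (V × V) → ℝ) (S : Finset V) : ℝ :=
  ∑ g ∈ E.powerset, μ g * ∑ v ∈ reach g S, w E A v

lemma reach_mono {V : Type*} [Fintype V] (g : Finset (V × V)) : Monotone (reach g) := by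
  intro S T hST x hx
  simp only [reach, mem_filter, mem_univ, true_and] at hx ⊢
  obtain ⟨u, hu, hux⟩ := hx
  exact ⟨u, hST hu, hux⟩

lemma reach_union {V : Type*} [Fintype V] (g : Finset (V × V)) (S T : Finset V) :
    reach g (S ∪ T) = reach g S ∪ reach g T := by
  ext x
  simp only [reach, mem_filter, mem_univ, true_and, mem_union, or_and_right, exists_or]

lemma w_nonneg {V : Type*} [Fintype V] {E : Finset (V × V)} {A : V × V → ℝ}
    (hA : ∀ e ∈ E, 0 ≤ A e) (v : V) : 0 ≤ w E A v :=
  mul_nonneg (by norm_num) (add_nonneg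
    (sum_nonneg fun _ hu => hA _ (mem_filter.1 hu).2)
    (sum_nonneg fun _ hu => hA _ (mem_filter.1 hu).2))

lemma sum_union_sub_sum {α : Type*} (f : α → ℝ) (s t : Finset α) :
    ∑ x ∈ s ∪ t, f x - ∑ x ∈ s, f x = ∑ x ∈ t \ s, f x := by
  rw [← union_sdiff_self_eq_union, sum_union disjoint_sdiff, add_sub_cancel_left]

/-- The upper bound `δ_U` is submodular. -/
theorem deltaU_submodular {V : Type*} [Fintype V]
    (E : Finset (V × V)) (A : V × V → ℝ) (μ : Finset (V × V) → ℝ)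
    (hA : ∀ e ∈ E, 0 ≤ A e) (hA0 : ∀ e ∉ E, A e = 0)
    (hμ : ∀ g ∈ E.powerset, 0 ≤ μ g) (hμ1 : ∑ g ∈ E.powerset, μ g = 1)
    (M N : Finset V) (hMN : M ⊆ N) (v : V) (hv : v ∉ N) :
    deltaU E A μ (M ∪ {v}) - deltaU E A μ M ≥
      deltaU E A μ (N ∪ {v}) - deltaU E A μ N := by
  simp only [deltaU, ge_iff_le, ← sum_sub_distrib, ← mul_sub, reach_union, sum_union_sub_sum]
  refine sum_le_sum fun g hg => mul_le_mul_of_nonneg_left ?_ (hμ g hg)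
  exact sum_le_sum_of_subset_of_nonneg (sdiff_subset_sdiff subset_rfl (reach_mono g hMN))
    fun x _ _ => w_nonneg hA x
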